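/- Let (S, Γ) be a counter machine and (s⁰, z₁⁰, z₂⁰) an initial configuration. Let D = {(-1,0),(0,-1),(0,0),(1,0),(0,1)} and define a counter machine (S', Γ') with S' = S ⊕ (S × D) by: Γ'(inl s, b₁, b₂) = (inr (s', Δ), Δ) where (s', Δ) = Γ(s, b₁, b₂), and Γ'(inr (s', Δ), b₁, b₂) = (inl s', (0,0)). Then (S', Γ') is a simplified counter machine, and (S', Γ') started at (inl s⁰, z₁⁰, z₂⁰) is stable if and only if (S, Γ) started at (s⁰, z₁⁰, z₂⁰) is stable. -/

import Mathlib

/-- The set of allowed counter increments of a two-counter machine. -/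
def CM.Deltas : Set (ℤ × ℤ) := {(-1, 0), (0, -1), (0, 0), (1, 0), (0, 1)}

/-- One step of a two-counter machine with transition function `Γ`:
a configuration `(s, z₁, z₂)` is updated to `(s', (z₁ + d₁)⁺, (z₂ + d₂)⁺)`
where `(s', (d₁, d₂)) = Γ s 1{z₁ > 0} 1{z₂ > 0}`. -/
def CM.step {S : Type*} (Γ : S → Bool → Bool → S × ℤ × ℤ) (c : S × ℕ × ℕ) : S × ℕ × ℕ :=
  let r := Γ c.1 (decide (0 < c.2.1)) (decide (0 < c.2.2))
  (r.1, ((c.2.1 : ℤ) + r.2.1).toNat, ((c.2.2 : ℤ) + r.2.2).toNat)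

/-- The trajectory of the counter machine `Γ` started from configuration `c`. -/
def CM.traj {S : Type*} (Γ : S → Bool → Bool → S × ℤ × ℤ) (c : S × ℕ × ℕ) (t : ℕ) :
    S × ℕ × ℕ :=
  (CM.step Γ)^[t] c

/-- `Γ` is a valid counter-machine transition function: every increment lies in
`CM.Deltas`, and `Γ` is consistent (it never decrements a counter whose value is zero). -/
def CM.Valid {S : Type*} (Γ : S → Bool → Bool → S × ℤ × ℤ) : Prop :=
  (∀ s b₁ b₂, (Γ s b₁ b₂).2 ∈ CM.Deltas) ∧
  (∀ s b₁ b₂, ((Γ s b₁ b₂).2.1 = -1 → b₁ = true) ∧ ((Γ s b₁ b₂).2.2 = -1 → b₂ = true))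

/-- The machine `Γ` started at configuration `c` is stable: both counter values
are bounded along the trajectory. -/
def CM.Stable {S : Type*} (Γ : S → Bool → Bool → S × ℤ × ℤ) (c : S × ℕ × ℕ) : Prop :=
  ∃ B : ℕ, ∀ t : ℕ, (CM.traj Γ c t).2.1 ≤ B ∧ (CM.traj Γ c t).2.2 ≤ B

/-- `Γ` is a simplified counter machine: the increment applied at each step is a
function of the new state only. -/
def CM.IsSCM {S : Type*} (Γ : S → Bool → Bool → S × ℤ × ℤ) : Prop :=
  ∃ (α : S → Bool → Bool → S) (β : S → ℤ × ℤ),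
    ∀ s b₁ b₂, Γ s b₁ b₂ = (α s b₁ b₂, β (α s b₁ b₂))

/-- The allowed increments, as a type. -/
def CM.Delta : Type := {d : ℤ × ℤ // d ∈ CM.Deltas}

/-- The simplified counter machine associated to a counter machine `Γ`, with state
space `S ⊕ (S × D)`: `Γ' (inl s) b₁ b₂ = (inr (s', Δ), Δ)` where `(s', Δ) = Γ s b₁ b₂`,
and `Γ' (inr (s', Δ)) b₁ b₂ = (inl s', (0, 0))`. -/
def CM.simplify {S : Type*} (Γ : S → Bool → Bool → S × ℤ × ℤ)
    (h : ∀ s b₁ b₂, (Γ s b₁ b₂).2 ∈ CM.Deltas) :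
    (S ⊕ S × CM.Delta) → Bool → Bool → (S ⊕ S × CM.Delta) × ℤ × ℤ
  | Sum.inl s, b₁, b₂ =>
      (Sum.inr ((Γ s b₁ b₂).1, ⟨(Γ s b₁ b₂).2, h s b₁ b₂⟩), (Γ s b₁ b₂).2)
  | Sum.inr p, _, _ => (Sum.inl p.1, (0, 0))

namespace CM

variable {S : Type*} {Γ : S → Bool → Bool → S × ℤ × ℤ}

theorem Valid.simplify (hΓ : Valid Γ) : Valid (simplify Γ hΓ.1) := by
  refine ⟨?_, ?_⟩
  · rintro (s | p) b₁ b₂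
    · exact hΓ.1 s b₁ b₂
    · simp [CM.simplify, Deltas]
  · rintro (s | p) b₁ b₂
    · exact hΓ.2 s b₁ b₂
    · simp [CM.simplify]

theorem isSCM_simplify (h : ∀ s b₁ b₂, (Γ s b₁ b₂).2 ∈ Deltas) : IsSCM (simplify Γ h) := by
  refine ⟨fun s b₁ b₂ => (simplify Γ h s b₁ b₂).1,
    Sum.elim (fun _ => (0, 0)) (fun p => p.2.1), ?_⟩
  rintro (s | p) b₁ b₂ <;> rfl

/-- The first half of a simulated step already updates the counters. -/
theorem step_simplify_inl_counters (h : ∀ s b₁ b₂, (Γ s b₁ b₂).2 ∈ Deltas) (c : S × ℕ × ℕ) :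
    (step (simplify Γ h) (Sum.inl c.1, c.2)).2 = (step Γ c).2 := rfl

theorem step_step_simplify_inl (h : ∀ s b₁ b₂, (Γ s b₁ b₂).2 ∈ Deltas) (c : S × ℕ × ℕ) :
    step (simplify Γ h) (step (simplify Γ h) (Sum.inl c.1, c.2)) =
      (Sum.inl (step Γ c).1, (step Γ c).2) := by
  simp only [step, simplify, add_zero, Int.toNat_natCast]

theorem traj_succ (c : S × ℕ × ℕ) (t : ℕ) : traj Γ c (t + 1) = step Γ (traj Γ c t) :=
  Function.iterate_succ_apply' _ _ _

theorem traj_simplify_two_mul (h : ∀ s b₁ b₂, (Γ s b₁ b₂).2 ∈ Deltas) (c : S × ℕ × ℕ) (t : ℕ) :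
    traj (simplify Γ h) (Sum.inl c.1, c.2) (2 * t) =
      (Sum.inl (traj Γ c t).1, (traj Γ c t).2) := by
  induction t with
  | zero => rfl
  | succ t ih =>
    rw [Nat.mul_succ, traj_succ, traj_succ, ih, step_step_simplify_inl, traj_succ]

theorem traj_simplify_two_mul_add_one_counters (h : ∀ s b₁ b₂, (Γ s b₁ b₂).2 ∈ Deltas)
    (c : S × ℕ × ℕ) (t : ℕ) :
    (traj (simplify Γ h) (Sum.inl c.1, c.2) (2 * t + 1)).2 = (traj Γ c (t + 1)).2 := by
  rw [traj_succ, traj_simplify_two_mul, step_simplify_inl_counters, traj_succ]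

theorem stable_simplify_iff (h : ∀ s b₁ b₂, (Γ s b₁ b₂).2 ∈ Deltas) (c : S × ℕ × ℕ) :
    Stable (simplify Γ h) (Sum.inl c.1, c.2) ↔ Stable Γ c := by
  refine exists_congr fun B => ⟨fun hB t => ?_, fun hB t => ?_⟩
  · simpa only [traj_simplify_two_mul] using hB (2 * t)
  · obtain ⟨k, rfl | rfl⟩ := t.even_or_odd'
    · simpa only [traj_simplify_two_mul] using hB k
    · simpa only [traj_simplify_two_mul_add_one_counters] using hB (k + 1)

end CM

/-- Proposition 1: the construction `Γ ↦ Γ'` on state space `S ⊕ (S × D)` produces a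
(valid) simplified counter machine, and `Γ'` started at `(inl s⁰, z₁⁰, z₂⁰)` is stable
if and only if `Γ` started at `(s⁰, z₁⁰, z₂⁰)` is stable. -/
theorem simplify_isSCM_and_stable_iff {S : Type*} [Fintype S] [Nonempty S]
    (Γ : S → Bool → Bool → S × ℤ × ℤ) (hΓ : CM.Valid Γ)
    (s0 : S) (z10 z20 : ℕ) :
    CM.Valid (CM.simplify Γ hΓ.1) ∧ CM.IsSCM (CM.simplify Γ hΓ.1) ∧
      (CM.Stable (CM.simplify Γ hΓ.1) (Sum.inl s0, z10, z20) ↔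
        CM.Stable Γ (s0, z10, z20)) :=
  ⟨hΓ.simplify, CM.isSCM_simplify hΓ.1, CM.stable_simplify_iff hΓ.1 (s0, z10, z20)⟩
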